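/- arXiv:2111.02200 — 5 statements merged into one kernel-verified Lean document; each statement's English description precedes it below -/
import Mathlib

section
/- For every finite simple graph G on n vertices, the sum, over all subsets S of the vertex set of G, of the number of maximal independent sets of the induced subgraph G[S], is at most (1 + 3^{1/3})^n. -/
open SimpleGraph

/-- `I` is a maximal independent set of the induced subgraph `G[S]`: an independent set
contained in `S` maximal among independent sets contained in `S`. -/
def IsMaxIndepSetIn {V : Type*} (G : SimpleGraph V) (S I : Finset V) : Prop :=
  I ⊆ S ∧ (I : Set V).Pairwise (fun a b => ¬ G.Adj a b) ∧
    ∀ J : Finset V, J ⊆ S → (J : Set V).Pairwise (fun a b => ¬ G.Adj a b) → I ⊆ J → I = J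

lemma cube_le_three_pow (k : ℕ) : k ^ 3 ≤ 3 ^ k := by
  rcases Nat.lt_or_ge k 3 with hk | hk
  · interval_cases k <;> norm_num
  · induction k, hk using Nat.le_induction with
    | base => norm_num
    | succ k hk ih =>
      rw [pow_succ 3 k]
      nlinarith [Nat.mul_le_mul hk hk, Nat.mul_le_mul (Nat.mul_le_mul hk hk) hk,
        Nat.mul_le_mul_right (k * k) hk]

lemma natCast_le_cbrt_three_pow (k : ℕ) : (k : ℝ) ≤ ((3 : ℝ) ^ ((1 : ℝ) / 3)) ^ k := by
  have hc : ((3 : ℝ) ^ ((1 : ℝ) / 3)) ^ 3 = 3 := by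
    rw [← Real.rpow_natCast, ← Real.rpow_mul (by norm_num)]
    norm_num
  refine le_of_pow_le_pow_left₀ (n := 3) (by norm_num) (by positivity) ?_
  rw [← pow_mul, mul_comm k 3, pow_mul, hc]
  exact_mod_cast cube_le_three_pow k

/-- Every vertex of `S` is dominated by a maximal independent set of `G[S]`. -/
lemma IsMaxIndepSetIn.exists_dominating {V : Type*} {G : SimpleGraph V} {S I : Finset V}
    (h : IsMaxIndepSetIn G S I) {v : V} (hv : v ∈ S) : ∃ u ∈ I, u = v ∨ G.Adj v u := by
  classical
  by_contra! hcon
  have hvI : v ∉ I := fun hvI => (hcon v hvI).1 rfl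
  have hI : I = insert v I := by
    refine h.2.2 _ (Finset.insert_subset hv h.1) ?_ (Finset.subset_insert v I)
    rw [Finset.coe_insert]
    refine h.2.1.insert fun b hb _ => ⟨(hcon b hb).2, fun hba => (hcon b hb).2 hba.symm⟩
  exact hvI (hI ▸ Finset.mem_insert_self v I)

/-- Removing a vertex `u` from a maximal independent set of `G[S]` leaves a maximal independent
set of `G[S \ N[u]]`. -/
lemma IsMaxIndepSetIn.erase {V : Type*} [DecidableEq V] {G : SimpleGraph V} [DecidableRel G.Adj]
    {S I : Finset V} (h : IsMaxIndepSetIn G S I) {u : V} (hu : u ∈ I) :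
    IsMaxIndepSetIn G {w ∈ S | ¬ (w = u ∨ G.Adj u w)} (I.erase u) := by
  refine ⟨fun w hw => ?_, h.2.1.mono (by simp), fun J hJS hJ hIJ => ?_⟩
  · obtain ⟨hwu, hwI⟩ := Finset.mem_erase.1 hw
    exact Finset.mem_filter.2 ⟨h.1 hwI, not_or.2 ⟨hwu, h.2.1 hu hwI hwu.symm⟩⟩
  · have huJ : u ∉ J := fun huJ => (Finset.mem_filter.1 (hJS huJ)).2 (Or.inl rfl)
    have hI : I = insert u J := by
      refine h.2.2 _ (Finset.insert_subset (h.1 hu) fun w hw => (Finset.mem_filter.1 (hJS hw)).1)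
        ?_ (Finset.subset_insert_iff.2 hIJ)
      rw [Finset.coe_insert]
      refine hJ.insert fun b hb _ => ?_
      have hub : ¬ G.Adj u b := fun hub => (Finset.mem_filter.1 (hJS hb)).2 (Or.inr hub)
      exact ⟨hub, fun hbu => hub hbu.symm⟩
    rw [hI, Finset.erase_insert huJ]

/-- The Moon–Moser bound: `G[S]` has at most `3 ^ (|S| / 3)` maximal independent sets. -/
lemma ncard_isMaxIndepSetIn_le {V : Type*} [Fintype V] (G : SimpleGraph V) (S : Finset V) :
    ({I : Finset V | IsMaxIndepSetIn G S I}.ncard : ℝ) ≤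
      ((3 : ℝ) ^ ((1 : ℝ) / 3)) ^ S.card := by
  classical
  induction S using Finset.strongInduction with
  | H S ih =>
  rcases S.eq_empty_or_nonempty with rfl | hS
  · have hsub : {I : Finset V | IsMaxIndepSetIn G ∅ I} ⊆ {∅} :=
      fun I hI => Finset.subset_empty.1 hI.1
    have hle := Set.ncard_le_ncard hsub
    rw [Set.ncard_singleton] at hle
    simpa using hle
  · set c : ℝ := (3 : ℝ) ^ ((1 : ℝ) / 3)
    have hc1 : 1 ≤ c := Real.one_le_rpow (by norm_num) (by norm_num)
    let N : V → Finset V := fun u => {w ∈ S | w = u ∨ G.Adj u w}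
    obtain ⟨v, hv, hmin⟩ := S.exists_min_image (fun u => (N u).card) hS
    have hbranch : ∀ u ∈ N v, ({I : Finset V | IsMaxIndepSetIn G S I ∧ u ∈ I}.ncard : ℝ) ≤
        c ^ (S.card - (N v).card) := by
      intro u hu
      have huS : u ∈ S := (Finset.mem_filter.1 hu).1
      let T : Finset V := {w ∈ S | ¬ (w = u ∨ G.Adj u w)}
      have hTS : T ⊂ S := Finset.filter_ssubset.2 ⟨u, huS, by simp⟩
      have hcard : (N u).card + T.card = S.card := Finset.card_filter_add_card_filter_not _
      have hinj : {I : Finset V | IsMaxIndepSetIn G S I ∧ u ∈ I}.ncard ≤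
          {I : Finset V | IsMaxIndepSetIn G T I}.ncard := by
        refine Set.ncard_le_ncard_of_injOn (fun I => I.erase u) (fun I hI => hI.1.erase hI.2) ?_
        intro I hI J hJ hIJ
        rw [← Finset.insert_erase hI.2, ← Finset.insert_erase hJ.2]
        exact congrArg (insert u) hIJ
      calc ({I : Finset V | IsMaxIndepSetIn G S I ∧ u ∈ I}.ncard : ℝ)
          ≤ {I : Finset V | IsMaxIndepSetIn G T I}.ncard := by exact_mod_cast hinj
        _ ≤ c ^ T.card := ih T hTS
        _ ≤ c ^ (S.card - (N v).card) :=
            pow_le_pow_right₀ hc1 (by have := hmin u huS; omega)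
    have hcover : {I : Finset V | IsMaxIndepSetIn G S I} ⊆
        ⋃ u ∈ N v, {I : Finset V | IsMaxIndepSetIn G S I ∧ u ∈ I} := by
      intro I hI
      obtain ⟨u, huI, hu⟩ := hI.exists_dominating hv
      exact Set.mem_biUnion (Finset.mem_filter.2 ⟨hI.1 huI, hu⟩) ⟨hI, huI⟩
    have hunion := (Set.ncard_le_ncard hcover).trans (Finset.set_ncard_biUnion_le _ _)
    calc ({I : Finset V | IsMaxIndepSetIn G S I}.ncard : ℝ)
        ≤ ∑ u ∈ N v, ({I : Finset V | IsMaxIndepSetIn G S I ∧ u ∈ I}.ncard : ℝ) := by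
          exact_mod_cast hunion
      _ ≤ (N v).card * c ^ (S.card - (N v).card) := by
          simpa using Finset.sum_le_sum hbranch
      _ ≤ c ^ (N v).card * c ^ (S.card - (N v).card) := by
          gcongr
          exact natCast_le_cbrt_three_pow _
      _ = c ^ S.card := by
          rw [← pow_add, Nat.add_sub_cancel' (Finset.card_filter_le _ _)]

/-- For every finite simple graph `G` on `n` vertices, the sum over all
vertex subsets `S` of the number of maximal independent sets of `G[S]` is at most
`(1 + 3^(1/3))^n`. -/
theorem sum_card_maxIndepSets_le {V : Type*} [Fintype V] (G : SimpleGraph V) :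
    ∑ S : Finset V, ({I : Finset V | IsMaxIndepSetIn G S I}.ncard : ℝ) ≤
      (1 + (3 : ℝ) ^ ((1 : ℝ) / 3)) ^ (Fintype.card V) := by
  classical
  calc ∑ S : Finset V, ({I : Finset V | IsMaxIndepSetIn G S I}.ncard : ℝ)
      ≤ ∑ S : Finset V, ((3 : ℝ) ^ ((1 : ℝ) / 3)) ^ S.card :=
        Finset.sum_le_sum fun S _ => ncard_isMaxIndepSetIn_le G S
    _ = (1 + (3 : ℝ) ^ ((1 : ℝ) / 3)) ^ Fintype.card V := by
        rw [add_comm, ← Fintype.sum_pow_mul_eq_add_pow]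
        simp
end

section
/- Let (T, X) be a tree decomposition of a finite simple graph G = (V, E), and let A, B ⊆ V be disjoint sets of vertices such that every pair (a, b) with a ∈ A and b ∈ B is an edge of G. Then there exists a node t of T such that A ⊆ X_t or B ⊆ X_t. -/
open SimpleGraph

/-- A tree decomposition of `G` with tree `T` and bags `X`. -/
structure IsTreeDecomp {V ι : Type*} (G : SimpleGraph V) (T : SimpleGraph ι)
    (X : ι → Set V) : Prop where
  isTree : T.IsTree
  mem_bag : ∀ v : V, ∃ t, v ∈ X t
  edge_bag : ∀ ⦃u v : V⦄, G.Adj u v → ∃ t, u ∈ X t ∧ v ∈ X t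
  bags_connected : ∀ v : V, (T.induce {t | v ∈ X t}).Connected

namespace SimpleGraph

/-- Deleting a vertex with at most one neighbour keeps a connected vertex set connected. -/
theorem connected_induce_compl_singleton_preimage {ι : Type*} {T : SimpleGraph ι} {l : ι}
    (hl : (T.neighborSet l).Subsingleton) {S : Set ι} (hS : (T.induce S).Connected)
    (hne : S ≠ {l}) :
    ((T.induce {l}ᶜ).induce (Subtype.val ⁻¹' S : Set ({l}ᶜ : Set ι))).Connected := by
  have hpre : ((T.induce S).induce {x | x.1 ≠ l}).Preconnected := by
    refine hS.preconnected.induce_of_degree_eq_one fun v hv u hu w hw => ?_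
    obtain rfl : v.1 = l := by simpa using hv
    exact Subtype.ext (hl hu hw)
  let f : (T.induce S).induce {x | x.1 ≠ l} →g
      (T.induce {l}ᶜ).induce (Subtype.val ⁻¹' S : Set ({l}ᶜ : Set ι)) :=
    { toFun := fun x => ⟨⟨x.1.1, x.2⟩, x.1.2⟩
      map_rel' := fun h => h }
  have hne' : ∃ x ∈ S, x ≠ l := by
    by_contra! h
    obtain ⟨y⟩ := hS.nonempty
    exact hne (Set.eq_singleton_iff_nonempty_unique_mem.2 ⟨⟨y.1, y.2⟩, h⟩)
  obtain ⟨x, hx, hxl⟩ := hne'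
  have : Nonempty (Subtype.val ⁻¹' S : Set ({l}ᶜ : Set ι)) := ⟨⟨⟨x, hxl⟩, hx⟩⟩
  exact ⟨hpre.map f fun y => ⟨⟨⟨y.1.1, y.2⟩, y.1.2⟩, rfl⟩⟩

/-- A connected vertex set containing `l` and some other vertex contains a neighbour of `l`. -/
theorem exists_adj_mem_of_connected_induce {ι : Type*} {T : SimpleGraph ι} {l : ι} {S : Set ι}
    (hS : (T.induce S).Connected) (hlS : l ∈ S) (hne : S ≠ {l}) : ∃ p ∈ S, T.Adj l p := by
  have : Nontrivial S := Set.nontrivial_coe_sort.2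
    ((Set.nontrivial_iff_ne_singleton hlS).2 hne)
  obtain ⟨p, hp⟩ := hS.preconnected.exists_adj_of_nontrivial ⟨l, hlS⟩
  exact ⟨p.1, p.2, hp⟩

/-- If every member of a family of subtrees of a finite tree meets every member of a second
family, then one of the two families has a common vertex. -/
theorem IsTree.exists_forall_mem_or_forall_mem {ι α β : Type*} [Finite ι] {T : SimpleGraph ι}
    (hT : T.IsTree) (S : α → Set ι) (R : β → Set ι) (hS : ∀ a, (T.induce (S a)).Connected)
    (hR : ∀ b, (T.induce (R b)).Connected) (hSR : ∀ a b, (S a ∩ R b).Nonempty) :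
    ∃ t, (∀ a, t ∈ S a) ∨ ∀ b, t ∈ R b := by
  classical
  induction hn : Nat.card ι using Nat.strong_induction_on generalizing ι with
  | _ n ih =>
    subst hn
    have := Fintype.ofFinite ι
    rcases subsingleton_or_nontrivial ι with hι | hι
    · obtain ⟨t⟩ := hT.connected.nonempty
      refine ⟨t, Or.inl fun a => ?_⟩
      obtain ⟨x⟩ := (hS a).nonempty
      exact Subsingleton.elim x.1 t ▸ x.2
    obtain ⟨l, hdeg⟩ := hT.exists_vert_degree_one_of_nontrivial
    have hl : (T.neighborSet l).Subsingleton := fun u hu w hw =>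
      (degree_eq_one_iff_existsUnique_adj.1 hdeg).unique hu hw
    by_cases hSl : ∃ a, S a = {l}
    · obtain ⟨a, ha⟩ := hSl
      refine ⟨l, Or.inr fun b => ?_⟩
      simpa [ha] using hSR a b
    by_cases hRl : ∃ b, R b = {l}
    · obtain ⟨b, hb⟩ := hRl
      refine ⟨l, Or.inl fun a => ?_⟩
      simpa [hb] using hSR a b
    push Not at hSl hRl
    obtain ⟨t, ht⟩ := ih (Nat.card ({l}ᶜ : Set ι))
      (Finite.card_subtype_lt (x := l) (by simp))
      ⟨hT.connected.induce_compl_singleton_of_degree_eq_one hdeg, hT.isAcyclic.induce _⟩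
      (fun a => Subtype.val ⁻¹' S a) (fun b => Subtype.val ⁻¹' R b)
      (fun a => connected_induce_compl_singleton_preimage hl (hS a) (hSl a))
      (fun b => connected_induce_compl_singleton_preimage hl (hR b) (hRl b))
      (fun a b => by
        obtain ⟨x, hxS, hxR⟩ := hSR a b
        by_cases hx : x = l
        · subst hx
          obtain ⟨p, hpS, hp⟩ := exists_adj_mem_of_connected_induce (hS a) hxS (hSl a)
          obtain ⟨q, hqR, hq⟩ := exists_adj_mem_of_connected_induce (hR b) hxR (hRl b)
          obtain rfl := hl hp hq
          exact ⟨⟨p, hp.ne'⟩, hpS, hqR⟩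
        · exact ⟨⟨x, hx⟩, hxS, hxR⟩)
      rfl
    exact ⟨t.1, ht⟩

end SimpleGraph

/-- (Complete bipartite subgraph containment lemma) Let `(T, X)` be a
tree decomposition of a finite simple graph `G`, and let `A, B` be disjoint vertex sets
with every pair `(a, b)`, `a ∈ A`, `b ∈ B`, an edge of `G`. Then some bag contains `A`
or contains `B`. -/
theorem bipartite_subset_bag {V ι : Type*} [Finite V] [Finite ι]
    (G : SimpleGraph V) (T : SimpleGraph ι) (X : ι → Set V)
    (hT : IsTreeDecomp G T X) (A B : Set V) (hAB : Disjoint A B)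
    (hadj : ∀ a ∈ A, ∀ b ∈ B, G.Adj a b) :
    ∃ t, A ⊆ X t ∨ B ⊆ X t := by
  obtain ⟨t, ht⟩ := hT.isTree.exists_forall_mem_or_forall_mem
    (fun a : A => {t | a.1 ∈ X t}) (fun b : B => {t | b.1 ∈ X t})
    (fun a => hT.bags_connected a) (fun b => hT.bags_connected b)
    (fun a b => hT.edge_bag (hadj a a.2 b b.2))
  exact ⟨t, ht.imp (fun h a ha => h ⟨a, ha⟩) (fun h b hb => h ⟨b, hb⟩)⟩
end

section
/- Let (T, X) be a tree decomposition of a finite simple graph G = (V, E), let A, B ⊆ V be disjoint sets of vertices such that every pair (a, b) with a ∈ A and b ∈ B is an edge of G, and suppose there exists a node i of T with A ⊆ X_i. Then there exists a nonempty set of nodes T' inducing a connected subtree of T such that: (1) A ⊆ X_t for every t ∈ T'; (2) B ⊆ ∪_{t ∈ T'} X_t; and (3) the subtree induced by T' together with the bags X'_t = X_t ∩ (A ∪ B) for t ∈ T' is a tree decomposition of the induced subgraph G[A ∪ B]. -/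
open SimpleGraph

namespace SimpleGraph

variable {ι : Type*} {T : SimpleGraph ι}

/-- A set of nodes is path-convex if every path between two of its nodes stays inside it. -/
def PathConvex (T : SimpleGraph ι) (S : Set ι) : Prop :=
  ∀ ⦃u v : ι⦄, u ∈ S → v ∈ S → ∀ p : T.Walk u v, p.IsPath → ∀ x ∈ p.support, x ∈ S

lemma PathConvex.inter {S U : Set ι} (hS : T.PathConvex S) (hU : T.PathConvex U) :
    T.PathConvex (S ∩ U) :=
  fun _ _ hu hv p hp x hx => ⟨hS hu.1 hv.1 p hp x hx, hU hu.2 hv.2 p hp x hx⟩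

lemma PathConvex.connected_induce {S : Set ι} (hS : T.PathConvex S) (hT : T.Connected)
    (hne : S.Nonempty) : (T.induce S).Connected := by
  obtain ⟨u, hu⟩ := hne
  refine induce_connected_of_patches u hu fun {v} hv => ?_
  obtain ⟨p, hp, -⟩ := hT.exists_path_of_dist u v
  exact ⟨{x | x ∈ p.support}, fun x hx => hS hu hv p hp x hx, p.start_mem_support,
    p.end_mem_support, p.connected_induce_support.preconnected _ _⟩

lemma IsAcyclic.pathConvex (hT : T.IsAcyclic) {S : Set ι} (hS : (T.induce S).Preconnected) :
    T.PathConvex S := by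
  intro u v hu hv p hp x hx
  obtain ⟨q, hq⟩ := (hS ⟨u, hu⟩ ⟨v, hv⟩).exists_isPath
  let f := (Embedding.induce (G := T) S).toHom
  have hf : (q.map f).IsPath := hq.map (Embedding.induce (G := T) S).injective
  have hpq : p = q.map f :=
    congrArg Subtype.val ((hT.subsingleton_path u v).elim ⟨p, hp⟩ ⟨q.map f, hf⟩)
  have hx' : x ∈ q.support.map f := Walk.support_map f q ▸ hpq ▸ hx
  obtain ⟨y, -, rfl⟩ := List.mem_map.mp hx'
  exact y.2

lemma IsTree.pathConvex (hT : T.IsTree) {S : Set ι} (hS : (T.induce S).Connected) :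
    T.PathConvex S :=
  hT.isAcyclic.pathConvex hS.preconnected

/-- Every nonempty path-convex set `C` of nodes of a tree has a gate towards each node `i`:
a node of `C` which lies in every path-convex set that contains `i` and meets `C`. -/
lemma IsTree.exists_gate (hT : T.IsTree) {C : Set ι} (hC : T.PathConvex C)
    (hne : C.Nonempty) (i : ι) :
    ∃ c ∈ C, ∀ S : Set ι, T.PathConvex S → i ∈ S → (S ∩ C).Nonempty → c ∈ S := by
  obtain ⟨c, hc, hmin⟩ := exists_minimalFor_of_wellFoundedLT (· ∈ C) (T.dist i) hne
  refine ⟨c, hc, fun S hS hi ⟨d, hdS, hdC⟩ => ?_⟩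
  obtain ⟨p, hp, hpl⟩ := hT.connected.exists_path_of_dist i c
  obtain ⟨q, hq, -⟩ := hT.connected.exists_path_of_dist c d
  have hpC : ∀ x ∈ p.support, x ∈ C → x = c := by
    classical
    intro x hx hxC
    by_contra hne
    have h1 := Walk.length_takeUntil_lt_length hx hne
    have h2 := dist_le (p.takeUntil x hx)
    have h3 := hmin hxC
    omega
  have hpq : (p.append q).IsPath := by
    rw [Walk.isPath_def, Walk.support_append, List.nodup_append']
    refine ⟨hp.support_nodup, hq.support_nodup.sublist (List.tail_sublist _), ?_⟩
    intro x hxp hxq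
    obtain rfl := hpC x hxp (hC hc hdC q hq x (List.mem_of_mem_tail hxq))
    have := hq.support_nodup
    rw [← Walk.cons_tail_support] at this
    exact (List.nodup_cons.mp this).1 hxq
  exact hS hi hdS _ hpq c (by simp)

/-- The Helly property for three path-convex sets in a tree. -/
lemma IsTree.inter_inter_nonempty (hT : T.IsTree) {S U C : Set ι} (hS : T.PathConvex S)
    (hU : T.PathConvex U) (hC : T.PathConvex C) (hSU : (S ∩ U).Nonempty)
    (hSC : (S ∩ C).Nonempty) (hUC : (U ∩ C).Nonempty) : (S ∩ (U ∩ C)).Nonempty := by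
  obtain ⟨i, hiS, hiU⟩ := hSU
  obtain ⟨c, hc, h⟩ := hT.exists_gate hC (hSC.mono Set.inter_subset_right) i
  exact ⟨c, h S hS hiS hSC, h U hU hiU hUC, hc⟩

lemma Connected.induce_induce {S U : Set ι} (h : (T.induce (S ∩ U)).Connected) :
    ((T.induce S).induce {t : S | (t : ι) ∈ U}).Connected := by
  let f : T.induce (S ∩ U) →g (T.induce S).induce {t : S | (t : ι) ∈ U} :=
    ⟨fun t => ⟨⟨t.1, t.2.1⟩, t.2.2⟩, fun h => h⟩
  exact h.map f fun t => ⟨⟨t.1.1, t.1.2, t.2⟩, rfl⟩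

end SimpleGraph

/-- Let `(T, X)` be a tree decomposition of a finite simple graph `G`,
let `A, B` be disjoint vertex sets with every pair `(a, b)`, `a ∈ A`, `b ∈ B`, an edge of
`G`, and suppose some bag contains `A`. Then there is a nonempty set `T'` of nodes
inducing a connected subtree of `T` such that (1) `A ⊆ X t` for every `t ∈ T'`,
(2) `B ⊆ ⋃ t ∈ T', X t`, and (3) the induced subtree together with the bags
`X t ∩ (A ∪ B)` is a tree decomposition of the induced subgraph `G[A ∪ B]`. -/
theorem exists_induced_subtree {V ι : Type*} [Finite V] [Finite ι]
    (G : SimpleGraph V) (T : SimpleGraph ι) (X : ι → Set V)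
    (hT : IsTreeDecomp G T X) (A B : Set V) (hAB : Disjoint A B)
    (hadj : ∀ a ∈ A, ∀ b ∈ B, G.Adj a b) (i : ι) (hi : A ⊆ X i) :
    ∃ T' : Set ι, T'.Nonempty ∧ (T.induce T').Connected ∧
      (∀ t ∈ T', A ⊆ X t) ∧
      B ⊆ ⋃ t ∈ T', X t ∧
      IsTreeDecomp (G.induce (A ∪ B)) (T.induce T')
        (fun t => {v : ↥(A ∪ B) | (v : V) ∈ X (t : ι)}) := by
  have hX (v : V) : T.PathConvex {t | v ∈ X t} := hT.isTree.pathConvex (hT.bags_connected v)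
  have hmeet {C : Set ι} (hC : T.PathConvex C) (hne : C.Nonempty)
      (hCA : ∀ a ∈ A, ({t | a ∈ X t} ∩ C).Nonempty) : ∃ t ∈ C, A ⊆ X t := by
    obtain ⟨c, hc, h⟩ := hT.isTree.exists_gate hC hne i
    exact ⟨c, hc, fun a ha => h _ (hX a) (hi ha) (hCA a ha)⟩
  have hA : T.PathConvex {t | A ⊆ X t} := fun u v hu hv p hp x hx a ha =>
    hX a (hu ha) (hv ha) p hp x hx
  have hconn := hA.connected_induce hT.isTree.connected ⟨i, hi⟩
  have hB : ∀ b ∈ B, ∃ t, A ⊆ X t ∧ b ∈ X t := fun b hb => by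
    obtain ⟨t, hbt, hAt⟩ := hmeet (hX b) (hT.mem_bag b) fun a ha =>
      hT.edge_bag (hadj a ha b hb)
    exact ⟨t, hAt, hbt⟩
  have hAB' : ∀ v ∈ A ∪ B, ∃ t, A ⊆ X t ∧ v ∈ X t := by
    rintro v (hv | hv)
    exacts [⟨i, hi, hi hv⟩, hB v hv]
  refine ⟨{t | A ⊆ X t}, ⟨i, hi⟩, hconn, fun t ht => ht, fun b hb => ?_,
    ⟨hconn, hT.isTree.isAcyclic.induce _⟩, fun v => ?_, fun u v huv => ?_, fun v => ?_⟩
  · obtain ⟨t, hAt, hbt⟩ := hB b hb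
    exact Set.mem_biUnion hAt hbt
  · obtain ⟨t, hAt, hvt⟩ := hAB' v v.2
    exact ⟨⟨t, hAt⟩, hvt⟩
  · obtain ⟨u, hu⟩ := u
    obtain ⟨v, hv⟩ := v
    obtain hu' | hu' := hu
    · obtain ⟨t, hAt, hvt⟩ := hAB' v hv
      exact ⟨⟨t, hAt⟩, hAt hu', hvt⟩
    obtain hv' | hv' := hv
    · obtain ⟨t, hAt, hut⟩ := hB u hu'
      exact ⟨⟨t, hAt⟩, hut, hAt hv'⟩
    obtain ⟨t, ⟨hut, hvt⟩, hAt⟩ := hmeet ((hX u).inter (hX v)) (hT.edge_bag huv) fun a ha =>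
      hT.isTree.inter_inter_nonempty (hX a) (hX u) (hX v) (hT.edge_bag (hadj a ha u hu'))
        (hT.edge_bag (hadj a ha v hv')) (hT.edge_bag huv)
    exact ⟨⟨t, hAt⟩, hut, hvt⟩
  · exact ((hA.inter (hX v)).connected_induce hT.isTree.connected (hAB' v v.2)).induce_induce
end

section
/- Let G be a finite simple graph with vertex set V, let 𝓜 be the family of maximal independent sets of G, and let k be a natural number. For S ⊆ V let α(S) be the number of sets M ∈ 𝓜 with M ∩ S = ∅, and let c_k(G) be the number of k-element subsets of 𝓜 whose union is V. Then, as integers, c_k(G) = Σ_{S ⊆ V} (−1)^{|S|} · binom(α(S), k), where binom denotes the binomial coefficient. -/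
open SimpleGraph

/-- `I` is a maximal independent set of `G`: pairwise nonadjacent and not properly
contained in any other independent set of `G`. -/
def IsMaxIndepSet {V : Type*} (G : SimpleGraph V) (I : Set V) : Prop :=
  I.Pairwise (fun a b => ¬ G.Adj a b) ∧
    ∀ J : Set V, J.Pairwise (fun a b => ¬ G.Adj a b) → I ⊆ J → I = J

open Classical in
/-- Inclusion–exclusion for the `k`-element subfamilies of a finite family of sets that cover a
finite type. -/
theorem card_covers_of_finset {V : Type*} [Fintype V] (A : Finset (Set V)) (k : ℕ) :
    (((A.powersetCard k).filter fun F => (⋃ I ∈ F, I) = Set.univ).card : ℤ) =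
      ∑ S : Finset V, (-1 : ℤ) ^ S.card *
        (((A.filter fun M => M ∩ (S : Set V) = ∅).card.choose k : ℕ) : ℤ) := by
  have key := Finset.inclusion_exclusion_sum_inf_compl (Finset.univ : Finset V)
    (fun v => Finset.univ.filter fun F : Finset (Set V) => ∀ I ∈ F, v ∉ I)
    (fun F => if F ∈ A.powersetCard k then (1 : ℤ) else 0)
  simp only [Finset.powerset_univ, smul_eq_mul, ← Finset.sum_filter, Finset.sum_const,
    nsmul_eq_mul, mul_one] at key
  convert key using 3 with S
  · rfl
  · ext F
    simp [Finset.mem_inf, Set.eq_univ_iff_forall, and_comm]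
  · rw [← Finset.card_powersetCard]
    refine congrArg (fun s => ((Finset.card s : ℕ) : ℤ)) ?_
    ext F
    simp only [Finset.mem_powersetCard, Finset.subset_iff, Finset.mem_filter, Finset.mem_inf,
      Finset.mem_univ, true_and, ← Set.disjoint_iff_inter_eq_empty, Set.disjoint_right,
      Finset.mem_coe]
    grind

/-- (Inclusion–exclusion for covers by maximal independent sets)
Let `𝓜` be the family of maximal independent sets of a finite simple graph `G`. For
`S ⊆ V` let `α(S)` be the number of `M ∈ 𝓜` disjoint from `S`, and let `c_k(G)` be the
number of `k`-element subsets of `𝓜` whose union is `V`. Then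
`c_k(G) = Σ_{S ⊆ V} (−1)^{|S|} · C(α(S), k)`. -/
theorem card_covers_eq_inclusion_exclusion {V : Type*} [Fintype V]
    (G : SimpleGraph V) (k : ℕ) :
    (({F : Finset (Set V) | F.card = k ∧ (∀ I ∈ F, IsMaxIndepSet G I) ∧
        (⋃ I ∈ F, I) = Set.univ}.ncard : ℤ)) =
      ∑ S : Finset V, (-1 : ℤ) ^ S.card *
        (({M : Set V | IsMaxIndepSet G M ∧ M ∩ (S : Set V) = ∅}.ncard).choose k : ℤ) := by
  classical
  have hcovers : {F : Finset (Set V) | F.card = k ∧ (∀ I ∈ F, IsMaxIndepSet G I) ∧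
      (⋃ I ∈ F, I) = Set.univ} =
      ((((Finset.univ.filter (IsMaxIndepSet G)).powersetCard k).filter
        fun F => (⋃ I ∈ F, I) = Set.univ : Finset (Finset (Set V))) : Set _) := by
    ext F
    simp only [Set.mem_ofPred_eq, Finset.coe_filter, Finset.mem_powersetCard, Finset.subset_iff,
      Finset.mem_filter, Finset.mem_univ, true_and]
    tauto
  have havoid (S : Finset V) : {M : Set V | IsMaxIndepSet G M ∧ M ∩ (S : Set V) = ∅} =
      (((Finset.univ.filter (IsMaxIndepSet G)).filter
        fun M => M ∩ (S : Set V) = ∅ : Finset (Set V)) : Set _) := by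
    ext M
    simp
  simp only [hcovers, havoid, Set.ncard_coe_finset]
  exact card_covers_of_finset _ k
end

section
/- For every finite simple graph G and natural number k, the tree-width satisfies tw(G) ≤ k if and only if there exists a chordal graph H on the same vertex set as G such that every edge of G is an edge of H and the clique number of H satisfies ω(H) ≤ k + 1. -/
open SimpleGraph

/-- Tree-width: the least `k` such that `G` has a tree decomposition (indexed by a
finite tree) in which every bag has at most `k + 1` vertices. -/
noncomputable def treeWidth {V : Type*} (G : SimpleGraph V) : ℕ :=
  sInf {k | ∃ (n : ℕ) (T : SimpleGraph (Fin n)) (X : Fin n → Set V),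
    IsTreeDecomp G T X ∧ ∀ t, (X t).ncard ≤ k + 1}

/-- A graph is chordal if every cycle of length at least 4 has a chord: an edge of the
graph joining two vertices of the cycle that are not consecutive on the cycle. -/
def IsChordal {V : Type*} (H : SimpleGraph V) : Prop :=
  ∀ ⦃v : V⦄ (c : H.Walk v v), c.IsCycle → 4 ≤ c.length →
    ∃ a b : V, a ∈ c.support ∧ b ∈ c.support ∧ H.Adj a b ∧ s(a, b) ∉ c.edges

/-- Two vertices of a set inducing a connected subgraph are joined by a path inside the set. -/
lemma SimpleGraph.exists_isPath_support_subset {ι : Type*} {T : SimpleGraph ι}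
    {A : Set ι} (hA : (T.induce A).Connected) {a b : ι} (ha : a ∈ A) (hb : b ∈ A) :
    ∃ p : T.Walk a b, p.IsPath ∧ ∀ x ∈ p.support, x ∈ A := by
  obtain ⟨p, hp⟩ := (hA.preconnected ⟨a, ha⟩ ⟨b, hb⟩).exists_isPath
  refine ⟨p.map (Embedding.induce A).toHom, hp.map (Embedding.induce (G := T) A).injective, ?_⟩
  intro x hx
  obtain ⟨y, -, rfl⟩ := List.mem_map.1 <| Eq.mp
    (congrArg (x ∈ ·) (Walk.support_map (Embedding.induce (G := T) A).toHom p)) hx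
  exact y.2

/-- In a tree rooted at `r`, a connected set `A` has a vertex `a` closest to `r` such that the path
to `r` from any vertex of `A` runs inside `A` up to `a`. -/
lemma SimpleGraph.IsTree.exists_top {ι : Type*} [Finite ι] {T : SimpleGraph ι} (hT : T.IsTree)
    (r : ι) {A : Set ι} (hA : (T.induce A).Connected) :
    ∃ a ∈ A, ∀ t ∈ A, ∀ p : T.Walk t r, p.IsPath →
      ∃ (s : T.Walk t a) (q : T.Walk a r), p = s.append q ∧ (∀ x ∈ s.support, x ∈ A) ∧
        q.length = T.dist a r := by
  classical
  obtain ⟨⟨a₀, ha₀⟩⟩ := hA.nonempty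
  obtain ⟨a, ha, hmin⟩ := Set.exists_min_image A (T.dist · r) A.toFinite ⟨a₀, ha₀⟩
  refine ⟨a, ha, fun t ht p hp ↦ ?_⟩
  obtain ⟨s, hs, hsA⟩ := exists_isPath_support_subset hA ht ha
  obtain ⟨q, hq, hql⟩ := hT.connected.exists_path_of_dist a r
  refine ⟨s, q, ?_, hsA, hql⟩
  have hmeet : ∀ x ∈ s.support, x ∈ q.support → x = a := by
    intro x hxs hxq
    have h1 := hmin x (hsA x hxs)
    have h2 := T.dist_le (q.dropUntil x hxq)
    have h3 := congrArg Walk.length (q.take_spec hxq)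
    rw [Walk.length_append] at h3
    exact (Walk.eq_of_length_eq_zero (p := q.takeUntil x hxq) (by omega)).symm
  have hsq : (s.append q).IsPath := by
    rw [Walk.isPath_def, Walk.support_append, List.nodup_append]
    refine ⟨hs.support_nodup, hq.support_nodup.tail, ?_⟩
    rintro x hxs y hyq rfl
    have hxa := hmeet x hxs (List.mem_of_mem_tail hyq)
    have hnd := hq.support_nodup
    rw [← Walk.cons_tail_support] at hnd
    exact (List.nodup_cons.1 hnd).1 (hxa ▸ hyq)
  exact (hT.existsUnique_path t r).unique hp hsq

/-- Among nonempty finitely many vertices whose sets of nodes are subtrees, some vertex has a bag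
containing all the vertices it shares a bag with. -/
lemma SimpleGraph.IsTree.exists_mem_forall_mem_bag {V ι : Type*} [Finite ι] {T : SimpleGraph ι}
    (hT : T.IsTree) {X : ι → Set V} {S : Set V} (hS : S.Finite) (hne : S.Nonempty)
    (hX : ∀ v ∈ S, (T.induce {t | v ∈ X t}).Connected) :
    ∃ v ∈ S, ∃ t, v ∈ X t ∧ ∀ w ∈ S, (∃ t', v ∈ X t' ∧ w ∈ X t') → w ∈ X t := by
  have := hT.connected.nonempty
  let r : ι := Classical.arbitrary ι
  choose! top htop htop' using fun v (hv : v ∈ S) ↦ hT.exists_top r (hX v hv)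
  obtain ⟨v, hv, hmax⟩ := Set.exists_max_image S (fun v ↦ T.dist (top v) r) hS hne
  refine ⟨v, hv, top v, htop v hv, ?_⟩
  rintro w hw ⟨t, hvt, hwt⟩
  obtain ⟨p, hp⟩ := (hT.connected.preconnected t r).exists_isPath
  obtain ⟨s₁, q₁, hp₁, -, hq₁⟩ := htop' v hv t hvt p hp
  obtain ⟨s₂, q₂, hp₂, hs₂, hq₂⟩ := htop' w hw t hwt p hp
  have hle := hmax w hw
  have h1 := congrArg Walk.length hp₁
  have h2 := congrArg Walk.length hp₂
  rw [Walk.length_append] at h1 h2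
  have h3 : p.getVert s₁.length = top v := by rw [hp₁, Walk.getVert_append]; simp
  have h4 : p.getVert s₁.length = s₂.getVert s₁.length := by
    rw [hp₂, Walk.getVert_append', if_pos (by omega)]
  rw [← h3, h4]
  exact hs₂ _ (s₂.getVert_mem_support _)

/-- Vertices pairwise sharing a bag of a tree decomposition lie in a common bag. -/
lemma SimpleGraph.IsTree.exists_bag_superset {V ι : Type*} [Finite ι] {T : SimpleGraph ι}
    (hT : T.IsTree) {X : ι → Set V} {S : Set V} (hS : S.Finite)
    (hX : ∀ v ∈ S, (T.induce {t | v ∈ X t}).Connected)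
    (hpair : ∀ v ∈ S, ∀ w ∈ S, v ≠ w → ∃ t, v ∈ X t ∧ w ∈ X t) :
    ∃ t, S ⊆ X t := by
  obtain rfl | hne := S.eq_empty_or_nonempty
  · exact ⟨hT.connected.nonempty.some, Set.empty_subset _⟩
  obtain ⟨v, hv, t, hvt, ht⟩ := hT.exists_mem_forall_mem_bag hS hne hX
  refine ⟨t, fun w hw ↦ ?_⟩
  obtain rfl | hvw := eq_or_ne v w
  · exact hvt
  · exact ht w hw (hpair v hv w hw hvw)

/-- The graph joining distinct vertices that share a bag. -/
def bagFill {V ι : Type*} (X : ι → Set V) : SimpleGraph V where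
  Adj u v := u ≠ v ∧ ∃ t, u ∈ X t ∧ v ∈ X t
  symm := ⟨fun _ _ ⟨h, t, hu, hv⟩ ↦ ⟨h.symm, t, hv, hu⟩⟩
  loopless := ⟨fun _ h ↦ h.1 rfl⟩

/-- If every nonempty finite set of vertices contains a vertex whose neighbors in the set form a
clique, then the graph is chordal. -/
lemma IsChordal.of_forall_exists_simplicial {V : Type*} {H : SimpleGraph V}
    (h : ∀ S : Set V, S.Finite → S.Nonempty → ∃ v ∈ S, H.IsClique (S ∩ H.neighborSet v)) :
    IsChordal H := by
  classical
  intro u c hc hlen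
  obtain ⟨v, hv, hvc⟩ := h {x | x ∈ c.support} c.support.finite_toSet ⟨u, c.start_mem_support⟩
  have hd := hc.rotate hv
  have hmem : ∀ x, x ∈ (c.rotate v hv).support ↔ x ∈ c.support :=
    fun x ↦ c.mem_support_rotate_iff v hv
  have hedges : ∀ e, e ∈ (c.rotate v hv).edges ↔ e ∈ c.edges :=
    fun e ↦ (c.rotate_edges v hv).mem_iff
  have hdlen : (c.rotate v hv).length = c.length := c.length_rotate v hv
  generalize c.rotate v hv = d at hd hmem hedges hdlen
  refine ⟨d.snd, d.penultimate, (hmem _).1 (d.getVert_mem_support _),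
    (hmem _).1 (d.getVert_mem_support _), ?_, ?_⟩
  · refine hvc ⟨(hmem _).1 (d.getVert_mem_support _), d.adj_snd hd.not_nil⟩
      ⟨(hmem _).1 (d.getVert_mem_support _), (d.adj_penultimate hd.not_nil).symm⟩
      hd.snd_ne_penultimate
  · rw [← hedges, Walk.mk_mem_edges_iff_exists]
    rintro ⟨i, hi, he⟩
    have hinj : ∀ m n, 1 ≤ m → m ≤ d.length → 1 ≤ n → n ≤ d.length →
        d.getVert m = d.getVert n → m = n :=
      fun m n h1 h2 h3 h4 h ↦ hd.getVert_injOn ⟨h1, h2⟩ ⟨h3, h4⟩ h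
    rw [Walk.snd, Walk.penultimate, Sym2.eq_iff] at he
    obtain rfl | hi0 := Nat.eq_zero_or_pos i
    · have h0 : d.getVert 0 = d.getVert d.length := by simp
      rw [h0] at he
      rcases he with ⟨h1, -⟩ | ⟨h1, -⟩ <;>
        have := hinj _ _ (by omega) (by omega) (by omega) (by omega) h1 <;> omega
    · rcases he with ⟨h1, h2⟩ | ⟨h1, h2⟩ <;>
        have := hinj _ _ (by omega) (by omega) (by omega) (by omega) h1 <;>
        have := hinj _ _ (by omega) (by omega) (by omega) (by omega) h2 <;> omega

/-- Chordality forbids two nonadjacent neighbors of `x` from being linked through vertices that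
are neither equal nor adjacent to `x`. -/
lemma IsChordal.adj_of_reachable {V : Type*} {H : SimpleGraph V} (hH : IsChordal H) {x a b : V}
    (hxa : H.Adj x a) (hxb : H.Adj x b) (hab : a ≠ b) {W : Set V}
    (hW : ∀ w ∈ W, w ≠ x ∧ (H.Adj x w → w = a ∨ w = b))
    (hreach : (H.induce W).spanningCoe.Reachable a b) : H.Adj a b := by
  classical
  by_contra hnadj
  obtain ⟨K, hK⟩ : ∃ K, K = (H.induce W).spanningCoe := ⟨_, rfl⟩
  rw [← hK] at hreach
  obtain ⟨p, hp, hpl⟩ := hreach.exists_path_of_dist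
  have hKadj : ∀ u v, K.Adj u v ↔ H.Adj u v ∧ u ∈ W ∧ v ∈ W := by
    intro u v
    simp [hK]
  have hKH : K ≤ H := fun u v h ↦ ((hKadj u v).1 h).1
  have hpos : p.length ≠ 0 := fun h ↦ hab (Walk.eq_of_length_eq_zero h)
  have hone : p.length ≠ 1 := fun h ↦ hnadj (hKH (p.adj_of_length_eq_one h))
  have hsupp : ∀ y ∈ p.support, y ∈ W := by
    intro y hy
    obtain ⟨i, rfl, hi⟩ := Walk.mem_support_iff_exists_getVert.1 hy
    obtain hlt | rfl := hi.lt_or_eq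
    · exact ((hKadj _ _).1 (p.adj_getVert_succ hlt)).2.1
    · have := p.adj_getVert_succ (i := p.length - 1) (by omega)
      rw [Nat.sub_add_cancel (by omega)] at this
      exact ((hKadj _ _).1 this).2.2
  have hchord : ∀ i j, i < j → j ≤ p.length → H.Adj (p.getVert i) (p.getVert j) → j = i + 1 := by
    intro i j hij hj hadj
    have hadj' : K.Adj (p.getVert i) (p.getVert j) :=
      (hKadj _ _).2 ⟨hadj, hsupp _ (p.getVert_mem_support _), hsupp _ (p.getVert_mem_support _)⟩
    have := K.dist_le ((p.take i).append (.cons hadj' (p.drop j)))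
    simp only [Walk.length_append, Walk.length_cons, Walk.take_length, Walk.drop_length,
      min_eq_left (hij.le.trans hj)] at this
    omega
  set q := p.mapLe hKH with hq
  have hqs : q.support = p.support := by simp [hq]
  have hqe : q.edges = p.edges := by simp [hq]
  have hql : q.length = p.length := by simp [hq]
  have hqp : q.IsPath := hp.mapLe hKH
  have hxq : x ∉ q.support := fun h ↦ (hW x (hsupp x (hqs ▸ h))).1 rfl
  have hcyc : (Walk.cons hxa (q.concat hxb.symm)).IsCycle := by
    rw [Walk.cons_isCycle_iff]
    refine ⟨hqp.concat hxq hxb.symm, ?_⟩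
    rw [Walk.edges_concat, List.concat_eq_append, List.mem_append]
    rintro (h | h)
    · exact hxq (q.fst_mem_support_of_mem_edges h)
    · simp only [List.mem_singleton, Sym2.eq_iff] at h
      rcases h with ⟨-, h⟩ | ⟨-, h⟩
      · exact hxa.ne h.symm
      · exact hab h
  obtain ⟨u, v, hu, hv, huv, hnot⟩ := hH _ hcyc
    (by rw [Walk.length_cons, Walk.length_concat]; omega)
  have hnx : ∀ w, H.Adj x w → w ∈ p.support →
      s(x, w) ∈ (Walk.cons hxa (q.concat hxb.symm)).edges := by
    intro w hxw hw
    rcases (hW w (hsupp w hw)).2 hxw with rfl | rfl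
    · simp
    · simp [Walk.edges_concat, Sym2.eq_swap]
  have hmem : ∀ w ∈ (Walk.cons hxa (q.concat hxb.symm)).support, w = x ∨ w ∈ p.support := by
    intro w hw
    simp only [Walk.support_cons, Walk.support_concat, hqs,
      List.mem_cons, List.mem_append, List.not_mem_nil, or_false] at hw
    tauto
  rcases hmem u hu with rfl | hup <;> rcases hmem v hv with rfl | hvp
  · exact huv.ne rfl
  · exact hnot (hnx v huv hvp)
  · exact hnot (Sym2.eq_swap ▸ hnx u huv.symm hup)
  · apply hnot
    obtain ⟨i, rfl, hi⟩ := Walk.mem_support_iff_exists_getVert.1 hup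
    obtain ⟨j, rfl, hj⟩ := Walk.mem_support_iff_exists_getVert.1 hvp
    have hpe : s(p.getVert i, p.getVert j) ∈ p.edges := by
      rw [Walk.mk_mem_edges_iff_exists]
      rcases lt_trichotomy i j with hij | rfl | hij
      · obtain rfl := hchord i j hij hj huv
        exact ⟨i, by omega, rfl⟩
      · exact (huv.ne rfl).elim
      · obtain rfl := hchord j i hij hi huv.symm
        exact ⟨j, by omega, Sym2.eq_swap⟩
    rw [Walk.edges_cons, Walk.edges_concat, hqe]
    simp [hpe]

/-- In a finite part `S` of a chordal graph, a vertex that is not adjacent to all of `S` has a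
non-neighbor in `S` whose neighbors in `S` form a clique. -/
lemma IsChordal.exists_simplicial_not_adj {V : Type*} {H : SimpleGraph V} (hH : IsChordal H)
    {S : Set V} (hS : S.Finite) {x y : V} (hx : x ∈ S) (hy : y ∈ S) (hyx : y ≠ x)
    (hxy : ¬ H.Adj x y) :
    ∃ v ∈ S, v ≠ x ∧ ¬ H.Adj x v ∧ H.IsClique (S ∩ H.neighborSet v) := by
  induction hn : S.ncard using Nat.strong_induction_on generalizing S x y with
  | _ n ih =>
  subst hn
  let D : Set V := {w | w ∈ S ∧ w ≠ x ∧ ¬ H.Adj x w}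
  have hyD : y ∈ D := ⟨hy, hyx, hxy⟩
  have hadj : ∀ (W : Set V) u v, (H.induce W).spanningCoe.Adj u v ↔ H.Adj u v ∧ u ∈ W ∧ v ∈ W := by
    intro W u v
    simp
  let C : Set V := {u | (H.induce D).spanningCoe.Reachable y u}
  have hCD : C ⊆ D := by
    rintro u ⟨p⟩
    by_cases hp : p.Nil
    · exact hp.eq ▸ hyD
    · exact ((hadj D _ _).1 (p.adj_penultimate hp)).2.2
  have hyC : y ∈ C := Reachable.refl y
  let B : Set V := {b | b ∈ S ∧ b ∉ C ∧ ∃ c ∈ C, H.Adj c b}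
  have hBx : ∀ b ∈ B, H.Adj x b := by
    rintro b ⟨hbS, hbC, c, hc, hcb⟩
    by_contra hxb
    have hbx : b ≠ x := by
      rintro rfl
      exact (hCD hc).2.2 hcb.symm
    exact hbC (Reachable.trans hc ((hadj D c b).2 ⟨hcb, hCD hc, hbS, hbx, hxb⟩).reachable)
  have hB : H.IsClique B := by
    intro a ha b hb hab
    obtain ⟨-, -, c, hc, hca⟩ := id ha
    obtain ⟨-, -, d, hd, hdb⟩ := id hb
    refine hH.adj_of_reachable (W := D ∪ {a, b}) (hBx a ha) (hBx b hb) hab ?_ ?_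
    · rintro w (hw | rfl | rfl)
      · exact ⟨hw.2.1, fun h ↦ (hw.2.2 h).elim⟩
      · exact ⟨(hBx w ha).ne', fun _ ↦ .inl rfl⟩
      · exact ⟨(hBx w hb).ne', fun _ ↦ .inr rfl⟩
    · have hmono : (H.induce D).spanningCoe ≤ (H.induce (D ∪ {a, b})).spanningCoe := fun u v h ↦
        (hadj _ u v).2 ⟨((hadj _ u v).1 h).1, .inl ((hadj _ u v).1 h).2.1,
          .inl ((hadj _ u v).1 h).2.2⟩
      have hac : (H.induce (D ∪ {a, b})).spanningCoe.Adj a c :=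
        (hadj _ a c).2 ⟨hca.symm, by simp, .inl (hCD hc)⟩
      have hdb' : (H.induce (D ∪ {a, b})).spanningCoe.Adj d b :=
        (hadj _ d b).2 ⟨hdb, .inl (hCD hd), by simp⟩
      exact hac.reachable.trans (((Reachable.trans (Reachable.symm hc) hd).mono hmono).trans
        hdb'.reachable)
  have hsub : C ∪ B ⊆ S := Set.union_subset (fun c hc ↦ (hCD hc).1) fun b hb ↦ hb.1
  have hlt : (C ∪ B).ncard < S.ncard := by
    refine Set.ncard_lt_ncard ⟨hsub, fun h ↦ ?_⟩ hS
    rcases h hx with h | h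
    · exact (hCD h).2.1 rfl
    · exact (hBx x h).ne rfl
  suffices h : ∃ v ∈ C, H.IsClique ((C ∪ B) ∩ H.neighborSet v) by
    obtain ⟨v, hv, hvc⟩ := h
    refine ⟨v, (hCD hv).1, (hCD hv).2.1, (hCD hv).2.2, hvc.subset ?_⟩
    rintro w ⟨hw, hvw⟩
    refine ⟨?_, hvw⟩
    by_cases hwC : w ∈ C
    · exact .inl hwC
    · exact .inr ⟨hw, hwC, v, hv, hvw⟩
  have hfin := hS.subset hsub
  by_cases hBu : ∃ b ∈ B, ∃ z ∈ C ∪ B, z ≠ b ∧ ¬ H.Adj b z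
  · obtain ⟨b, hb, z, hz, hzb, hbz⟩ := hBu
    obtain ⟨v, hv, hvb, hbv, hvc⟩ := ih _ hlt hfin (.inr hb) hz hzb hbz rfl
    exact ⟨v, hv.resolve_right fun h ↦ hbv (hB hb h hvb.symm), hvc⟩
  by_cases hCu : ∃ c ∈ C, ∃ z ∈ C ∪ B, z ≠ c ∧ ¬ H.Adj c z
  · obtain ⟨c, hc, z, hz, hzc, hcz⟩ := hCu
    obtain ⟨v, hv, hvc', hcv, hvc⟩ := ih _ hlt hfin (.inl hc) hz hzc hcz rfl
    exact ⟨v, hv.resolve_right fun h ↦ hBu ⟨v, h, c, .inl hc, hvc'.symm, fun h ↦ hcv h.symm⟩, hvc⟩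
  refine ⟨y, hyC, ?_⟩
  rintro a ⟨ha, -⟩ b ⟨hb, -⟩ hab
  by_contra hnot
  rcases ha with ha | ha
  · exact hCu ⟨a, ha, b, hb, hab.symm, hnot⟩
  · exact hBu ⟨a, ha, b, hb, hab.symm, hnot⟩

/-- Every nonempty finite part of a chordal graph has a simplicial vertex. -/
lemma IsChordal.exists_simplicial {V : Type*} {H : SimpleGraph V} (hH : IsChordal H)
    {S : Set V} (hS : S.Finite) (hne : S.Nonempty) :
    ∃ v ∈ S, H.IsClique (S ∩ H.neighborSet v) := by
  by_cases hc : H.IsClique S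
  · obtain ⟨v, hv⟩ := hne
    exact ⟨v, hv, hc.subset Set.inter_subset_left⟩
  · simp only [isClique_iff, Set.Pairwise, not_forall] at hc
    obtain ⟨x, hx, y, hy, hxy, hnadj⟩ := hc
    obtain ⟨v, hv, -, -, h⟩ := hH.exists_simplicial_not_adj hS hx hy (Ne.symm hxy) hnadj
    exact ⟨v, hv, h⟩

/-- The graph obtained from `T` by attaching a new leaf to the vertex `t`. -/
def attachLeaf {n : ℕ} (T : SimpleGraph (Fin n)) (t : Fin n) : SimpleGraph (Fin (n + 1)) :=
  T.map Fin.castSuccEmb ⊔ edge t.castSucc (Fin.last n)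

lemma attachLeaf_adj_last {n : ℕ} (T : SimpleGraph (Fin n)) (t : Fin n) :
    (attachLeaf T t).Adj t.castSucc (Fin.last n) :=
  .inr ((edge_adj ..).2 ⟨.inl ⟨rfl, rfl⟩, (Fin.castSucc_lt_last t).ne⟩)

lemma attachLeaf_induce_image_connected {n : ℕ} {T : SimpleGraph (Fin n)} (t : Fin n)
    {A : Set (Fin n)} (hA : (T.induce A).Connected) :
    ((attachLeaf T t).induce (Fin.castSucc '' A)).Connected := by
  let f : T →g attachLeaf T t := ⟨Fin.castSucc, fun h ↦ .inl (map_adj_apply.2 h)⟩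
  refine hA.map (induceHom f (Set.mapsTo_image _ A)) ?_
  rintro ⟨_, a, ha, rfl⟩
  exact ⟨⟨a, ha⟩, rfl⟩

lemma attachLeaf_induce_insert_connected {n : ℕ} {T : SimpleGraph (Fin n)} {t : Fin n}
    {A : Set (Fin n)} (hA : (T.induce A).Connected) (ht : t ∈ A) :
    ((attachLeaf T t).induce (insert (Fin.last n) (Fin.castSucc '' A))).Connected := by
  rw [Set.insert_eq]
  exact connected_induce_union Preconnected.of_subsingleton
    (attachLeaf_induce_image_connected t hA).preconnected rfl (Set.mem_image_of_mem _ ht)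
    (attachLeaf_adj_last T t).symm

lemma SimpleGraph.IsTree.attachLeaf {n : ℕ} {T : SimpleGraph (Fin n)} (hT : T.IsTree)
    (t : Fin n) : (attachLeaf T t).IsTree := by
  rw [isTree_iff_connected_and_card]
  constructor
  · have h := attachLeaf_induce_insert_connected (t := t)
      ((induceUnivIso T).connected_iff.2 hT.connected) (Set.mem_univ t)
    have huniv : insert (Fin.last n) (Fin.castSucc '' Set.univ) = Set.univ := by
      ext i
      induction i using Fin.lastCases <;> simp
    rw [huniv] at h
    exact (induceUnivIso _).connected_iff.1 h
  · have hcard := (isTree_iff_connected_and_card.1 hT).2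
    have hnot : s(t.castSucc, Fin.last n) ∉ (T.map Fin.castSuccEmb).edgeSet := by
      rw [mem_edgeSet, map_adj]
      rintro ⟨a, b, -, -, hb⟩
      exact (Fin.castSucc_lt_last b).ne hb
    rw [_root_.attachLeaf, edgeSet_sup, edgeSet_edge_of_ne (Fin.castSucc_lt_last t).ne,
      Set.union_singleton, Nat.card_coe_set_eq, Set.ncard_insert_of_notMem hnot, edgeSet_map,
      Set.ncard_image_of_injective _ (Function.Embedding.injective _), ← Nat.card_coe_set_eq,
      hcard]
    simp

/-- A finite part of a chordal graph has a tree decomposition into cliques. -/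
lemma IsChordal.exists_clique_tree {V : Type*} {H : SimpleGraph V} (hH : IsChordal H)
    {S : Set V} (hS : S.Finite) :
    ∃ (n : ℕ) (T : SimpleGraph (Fin n)) (X : Fin n → Set V), T.IsTree ∧
      (∀ v ∈ S, (T.induce {t | v ∈ X t}).Connected) ∧
      (∀ u ∈ S, ∀ v ∈ S, H.Adj u v → ∃ t, u ∈ X t ∧ v ∈ X t) ∧
      ∀ t, X t ⊆ S ∧ H.IsClique (X t) := by
  induction hn : S.ncard using Nat.strong_induction_on generalizing S with
  | _ n ih =>
  subst hn
  obtain rfl | hne := S.eq_empty_or_nonempty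
  · exact ⟨1, ⊥, fun _ ↦ ∅, .of_subsingleton, by simp, by simp, by simp⟩
  obtain ⟨v, hv, hvc⟩ := hH.exists_simplicial hS hne
  obtain ⟨n, T, X, hT, hconn, hedge, hX⟩ :=
    ih _ (Set.ncard_sdiff_singleton_lt_of_mem hv hS) (hS.subset Set.sdiff_subset) rfl
  have hNS : S ∩ H.neighborSet v ⊆ S \ {v} := fun w hw ↦ ⟨hw.1, hw.2.ne'⟩
  obtain ⟨t, ht⟩ := hT.exists_bag_superset (hS.subset Set.inter_subset_left)
    (fun w hw ↦ hconn w (hNS hw))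
    fun a ha b hb hab ↦ hedge a (hNS ha) b (hNS hb) (hvc ha hb hab)
  let Y : Fin (n + 1) → Set V :=
    Fin.snoc (α := fun _ ↦ Set V) X (insert v (S ∩ H.neighborSet v))
  have hYlast : Y (Fin.last n) = insert v (S ∩ H.neighborSet v) := Fin.snoc_last ..
  have hYcast : ∀ i : Fin n, Y i.castSucc = X i := fun i ↦ Fin.snoc_castSucc ..
  refine ⟨n + 1, attachLeaf T t, Y, hT.attachLeaf t, ?_, ?_, ?_⟩
  · intro u hu
    by_cases huv : u = v
    · have : {i | u ∈ Y i} = {Fin.last n} := by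
        ext i
        induction i using Fin.lastCases with
        | last => simp [hYlast, huv]
        | cast i =>
          simp only [Set.mem_ofPred_eq, hYcast, Set.mem_singleton_iff,
            (Fin.castSucc_lt_last i).ne, iff_false]
          exact fun h ↦ ((hX i).1 h).2 huv
      rw [this]
      exact { preconnected := .of_subsingleton, nonempty := ⟨⟨_, rfl⟩⟩ }
    have hcon := hconn u ⟨hu, huv⟩
    by_cases hvu : H.Adj v u
    · have : {i | u ∈ Y i} = insert (Fin.last n) (Fin.castSucc '' {i | u ∈ X i}) := by
        ext i
        induction i using Fin.lastCases <;> simp [hYlast, hYcast, hu, hvu]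
      rw [this]
      exact attachLeaf_induce_insert_connected hcon (ht ⟨hu, hvu⟩)
    · have : {i | u ∈ Y i} = Fin.castSucc '' {i | u ∈ X i} := by
        ext i
        induction i using Fin.lastCases <;> simp [hYlast, hYcast, hvu, huv]
      rw [this]
      exact attachLeaf_induce_image_connected t hcon
  · intro a ha b hb hab
    by_cases hav : a = v
    · subst hav
      exact ⟨Fin.last n, hYlast ▸ .inl rfl, hYlast ▸ .inr ⟨hb, hab⟩⟩
    by_cases hbv : b = v
    · subst hbv
      exact ⟨Fin.last n, hYlast ▸ .inr ⟨ha, hab.symm⟩, hYlast ▸ .inl rfl⟩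
    obtain ⟨i, hai, hbi⟩ := hedge a ⟨ha, hav⟩ b ⟨hb, hbv⟩ hab
    exact ⟨i.castSucc, (hYcast i).symm ▸ hai, (hYcast i).symm ▸ hbi⟩
  · intro i
    induction i using Fin.lastCases with
    | last =>
      rw [hYlast]
      exact ⟨Set.insert_subset hv Set.inter_subset_left, hvc.insert fun b hb _ ↦ hb.2⟩
    | cast i =>
      rw [hYcast]
      exact ⟨(hX i).1.trans Set.sdiff_subset, (hX i).2⟩

/-- A finite graph has a tree decomposition attaining its tree-width. -/
lemma exists_isTreeDecomp_treeWidth {V : Type*} [Finite V] (G : SimpleGraph V) :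
    ∃ (n : ℕ) (T : SimpleGraph (Fin n)) (X : Fin n → Set V),
      IsTreeDecomp G T X ∧ ∀ t, (X t).ncard ≤ treeWidth G + 1 := by
  refine Nat.sInf_mem (s := {k | ∃ (n : ℕ) (T : SimpleGraph (Fin n)) (X : Fin n → Set V),
    IsTreeDecomp G T X ∧ ∀ t, (X t).ncard ≤ k + 1})
    ⟨Nat.card V, 1, ⊥, fun _ ↦ Set.univ, ⟨.of_subsingleton, ?_, ?_, ?_⟩, ?_⟩
  · exact fun _ ↦ ⟨0, trivial⟩
  · exact fun _ _ _ ↦ ⟨0, trivial, trivial⟩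
  · exact fun _ ↦ { preconnected := .of_subsingleton, nonempty := ⟨⟨0, trivial⟩⟩ }
  · simp [Set.ncard_univ]

/-- For every finite simple graph `G` and natural number `k`,
`tw(G) ≤ k` iff there is a chordal graph `H` on the same vertex set containing all edges
of `G` with clique number `ω(H) ≤ k + 1`. -/
theorem treeWidth_le_iff_exists_chordal {V : Type*} [Finite V]
    (G : SimpleGraph V) (k : ℕ) :
    treeWidth G ≤ k ↔ ∃ H : SimpleGraph V, G ≤ H ∧ IsChordal H ∧
      ∀ s : Set V, H.IsClique s → s.ncard ≤ k + 1 := by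
  constructor
  · intro hk
    obtain ⟨n, T, X, hX, hcard⟩ := exists_isTreeDecomp_treeWidth G
    refine ⟨bagFill X, fun u v h ↦ ⟨h.ne, hX.edge_bag h⟩, ?_, fun s hs ↦ ?_⟩
    · refine IsChordal.of_forall_exists_simplicial fun S hS hne ↦ ?_
      obtain ⟨v, hv, t, -, ht⟩ :=
        hX.isTree.exists_mem_forall_mem_bag hS hne fun v _ ↦ hX.bags_connected v
      exact ⟨v, hv, fun a ha b hb hab ↦ ⟨hab, t, ht a ha.1 ha.2.2, ht b hb.1 hb.2.2⟩⟩
    · obtain ⟨t, ht⟩ := hX.isTree.exists_bag_superset s.toFinite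
        (fun v _ ↦ hX.bags_connected v) fun a ha b hb hab ↦ (hs ha hb hab).2
      exact (Set.ncard_le_ncard ht).trans ((hcard t).trans (by omega))
  · rintro ⟨H, hGH, hH, hclique⟩
    obtain ⟨n, T, X, hT, hconn, hedge, hX⟩ := hH.exists_clique_tree Set.finite_univ
    refine Nat.sInf_le ⟨n, T, X, ⟨hT, fun v ↦ ?_, fun u v h ↦ ?_, fun v ↦ ?_⟩, fun t ↦ ?_⟩
    · obtain ⟨⟨t, ht⟩⟩ := (hconn v trivial).nonempty
      exact ⟨t, ht⟩
    · exact hedge u trivial v trivial (hGH h)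
    · exact hconn v trivial
    · exact hclique _ (hX t).2
end
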